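/- Let R be a ring, 'C = 'C_R and a = ass_R('C). The following are equivalent: (1) 'C is a left denominator set of R and 'Q_{l,cl}(R) := 'C⁻¹R is a semisimple Artinian ring; (2) (a) a is a semiprime ideal of R and the set Min_R(a) of minimal primes over a is finite; (b) for each p ∈ Min_R(a), the set S_p := {c ∈ R | c + p ∈ C_{R/p}} is a left denominator set of R with ass_R(S_p) = p; (c) for each p ∈ Min_R(a), the ring S_p⁻¹R is a simple Artinian ring; (d) the set 'C̄ := {c + a | c ∈ 'C} is a dense subset of C_{R/a}. Moreover, if these conditions hold, then {S ∈ maxDen_l(R) | 'C ⊆ S} = {S_p | p ∈ Min_R(a)}, and 'Q_{l,cl}(R) ≅ ∏_{p ∈ Min_R(a)} S_p⁻¹R ≅ Q_{l,cl}(R/a) are semisimple Artinian rings. -/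

import Mathlib

universe u

namespace Bavula

/-- The set of left regular elements of `R`. -/
def lReg (R : Type u) [Ring R] : Set R := {c : R | ∀ x : R, x * c = 0 → x = 0}

/-- The set of right regular elements of `R`. -/
def rReg (R : Type u) [Ring R] : Set R := {c : R | ∀ x : R, c * x = 0 → x = 0}

/-- The set of regular elements of `R`. -/
def reg (R : Type u) [Ring R] : Set R := lReg R ∩ rReg R

/-- `S` is a multiplicative set of `R`. -/
def IsMulSet {R : Type u} [Ring R] (S : Set R) : Prop :=
  (1 : R) ∈ S ∧ (∀ a ∈ S, ∀ b ∈ S, a * b ∈ S) ∧ (0 : R) ∉ S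

/-- `S` is a left Ore set of `R`. -/
def IsLeftOre {R : Type u} [Ring R] (S : Set R) : Prop :=
  IsMulSet S ∧ ∀ s ∈ S, ∀ r : R, ∃ s' ∈ S, ∃ r' : R, s' * r = r' * s

/-- `S` is a left denominator set of `R`. -/
def IsLeftDenom {R : Type u} [Ring R] (S : Set R) : Prop :=
  IsLeftOre S ∧ ∀ r : R, ∀ s ∈ S, r * s = 0 → ∃ t ∈ S, t * r = 0

/-- `S` is a right Ore set of `R`. -/
def IsRightOre {R : Type u} [Ring R] (S : Set R) : Prop :=
  IsMulSet S ∧ ∀ s ∈ S, ∀ r : R, ∃ s' ∈ S, ∃ r' : R, r * s' = s * r'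

/-- `S` is a right denominator set of `R`. -/
def IsRightDenom {R : Type u} [Ring R] (S : Set R) : Prop :=
  IsRightOre S ∧ ∀ r : R, ∀ s ∈ S, s * r = 0 → ∃ t ∈ S, r * t = 0

/-- `ass_R(S) = {r ∈ R | s r = 0 for some s ∈ S}`. -/
def ass {R : Type u} [Ring R] (S : Set R) : Set R := {r : R | ∃ s ∈ S, s * r = 0}

/-- `{r ∈ R | r s = 0 for some s ∈ S}` (the right-sided analogue of `ass`). -/
def rass {R : Type u} [Ring R] (S : Set R) : Set R := {r : R | ∃ s ∈ S, r * s = 0}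

/-- `S` is a (left) dense subset of `T`. -/
def DenseIn {R : Type u} [Ring R] (S T : Set R) : Prop := ∀ t ∈ T, ∃ r : R, r * t ∈ S

/-- `f : R →+* Q` realizes `Q` as the left localization `S⁻¹R` of `R` at `S`:
elements of `S` become units, every element of `Q` is a left fraction `(f s)⁻¹ * (f r)`,
and the kernel of `f` is `ass S`. -/
def IsLeftLoc {R : Type u} [Ring R] (S : Set R) {Q : Type u} [Ring Q] (f : R →+* Q) : Prop :=
  (∀ s ∈ S, IsUnit (f s)) ∧
  (∀ q : Q, ∃ s ∈ S, ∃ r : R, f s * q = f r) ∧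
  (∀ r : R, f r = 0 ↔ r ∈ ass S)

/-- `π : R →+* Q` realizes `Q` as the quotient of `R` by the set `a`
(in particular, `a` is then a two-sided ideal of `R`). -/
def IsQuotBy {R : Type u} [Ring R] (a : Set R) {Q : Type u} [Ring Q] (π : R →+* Q) : Prop :=
  Function.Surjective π ∧ ∀ r : R, π r = 0 ↔ r ∈ a

/-- A semiprime ring (no nonzero nilpotent ideals), elementwise: `x R x = 0 → x = 0`. -/
def SemiprimeRing (A : Type u) [Ring A] : Prop := ∀ x : A, (∀ r : A, x * r * x = 0) → x = 0

/-- `a` is a two-sided ideal of `R`, given as a set. -/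
def IsIdealSet {R : Type u} [Ring R] (a : Set R) : Prop :=
  (0 : R) ∈ a ∧ (∀ x ∈ a, ∀ y ∈ a, x + y ∈ a) ∧ ∀ r : R, ∀ x ∈ a, r * x ∈ a ∧ x * r ∈ a

/-- `a` is a semiprime (two-sided) ideal of `R`, i.e. `R/a` is a semiprime ring. -/
def IsSemiprimeIdealSet {R : Type u} [Ring R] (a : Set R) : Prop :=
  IsIdealSet a ∧ ∀ x : R, (∀ r : R, x * r * x ∈ a) → x ∈ a

/-- `a` is a prime (two-sided) ideal of `R`, i.e. `R/a` is a prime ring. -/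
def IsPrimeIdealSet {R : Type u} [Ring R] (a : Set R) : Prop :=
  IsIdealSet a ∧ a ≠ Set.univ ∧ ∀ x y : R, (∀ r : R, x * r * y ∈ a) → x ∈ a ∨ y ∈ a

/-- The prime radical of `A`: the intersection of all prime ideals of `A`. -/
def primeRadical (A : Type u) [Ring A] : Set A :=
  {x : A | ∀ p : Set A, IsPrimeIdealSet p → x ∈ p}

/-- The set of prime ideals of `R` minimal over `a`. -/
def minPrimesOver {R : Type u} [Ring R] (a : Set R) : Set (Set R) :=
  {p : Set R | IsPrimeIdealSet p ∧ a ⊆ p ∧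
    ∀ q : Set R, IsPrimeIdealSet q → a ⊆ q → q ⊆ p → q = p}

/-- A simple ring: nontrivial, with no two-sided ideals other than `0` and `A`. -/
def SimpleRing (A : Type u) [Ring A] : Prop :=
  (0 : A) ≠ 1 ∧ ∀ a : Set A, IsIdealSet a → a = {0} ∨ a = Set.univ

/-- A simple (left) Artinian ring. -/
def SimpleArtinianRing (A : Type u) [Ring A] : Prop := SimpleRing A ∧ IsArtinianRing A

/-- `I` is an essential left ideal of `R`. -/
def EssIdeal {R : Type u} [Ring R] (I : Submodule R R) : Prop :=
  ∀ J : Submodule R R, J ≠ ⊥ → I ⊓ J ≠ ⊥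

/-- `N` is an essential submodule of the left ideal `M`. -/
def EssIn {R : Type u} [Ring R] (N M : Submodule R R) : Prop :=
  N ≤ M ∧ ∀ W : Submodule R R, W ≤ M → W ≠ ⊥ → N ⊓ W ≠ ⊥

/-- `U` is a uniform left ideal of `R`. -/
def UniformIdeal {R : Type u} [Ring R] (U : Submodule R R) : Prop :=
  U ≠ ⊥ ∧ ∀ V W : Submodule R R, V ≤ U → W ≤ U → V ≠ ⊥ → W ≠ ⊥ → V ⊓ W ≠ ⊥

/-- `udim(_A A) < ∞`: there is a finite direct sum of uniform left ideals of `A`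
which is an essential left ideal of `A`. -/
def FinUdim (A : Type u) [Ring A] : Prop :=
  ∃ (n : ℕ) (U : Fin (n + 1) → Submodule A A),
    (∀ i, UniformIdeal (U i)) ∧
    (∀ i, U i ⊓ (⨆ j, ⨆ (_ : j ≠ i), U j) = ⊥) ∧
    EssIdeal (⨆ i, U i)

/-- `'C_V = {v ∈ V | right multiplication by v is injective on V}` for a left ideal `V`. -/
def lRegIn {R : Type u} [Ring R] (V : Submodule R R) : Set R :=
  {v : R | v ∈ V ∧ ∀ x ∈ V, x * v = 0 → x = 0}

/-- The family `P` of subsets of `R` satisfies the ascending chain condition. -/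
def AccOnSets {R : Type u} [Ring R] (P : Set (Set R)) : Prop :=
  ∀ f : ℕ → Set R, (∀ n, f n ∈ P) → (∀ n, f n ⊆ f (n + 1)) →
    ∃ N : ℕ, ∀ n : ℕ, N ≤ n → f n = f N

/-- The left annihilator of `X` in `R`. -/
def lAnn {R : Type u} [Ring R] (X : Set R) : Set R := {r : R | ∀ x ∈ X, r * x = 0}

/-- The right annihilator of `X` in `R`. -/
def rAnn {R : Type u} [Ring R] (X : Set R) : Set R := {r : R | ∀ x ∈ X, x * r = 0}

/-- A left Goldie ring: a.c.c. on left annihilators and finite left uniform dimension. -/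
def LeftGoldie (A : Type u) [Ring A] : Prop :=
  AccOnSets {B : Set A | ∃ X : Set A, B = lAnn X} ∧ FinUdim A

/-- The set of maximal left denominator sets of `A`. -/
def maxLeftDenom (A : Type u) [Ring A] : Set (Set A) :=
  {S : Set A | IsLeftDenom S ∧ ∀ T : Set A, IsLeftDenom T → S ⊆ T → S = T}

/-- `S_p = {c ∈ R | c + p ∈ C_{R/p}}`: the elements regular modulo `p`. -/
def regMod {R : Type u} [Ring R] (p : Set R) : Set R :=
  {c : R | (∀ x : R, x * c ∈ p → x ∈ p) ∧ ∀ x : R, c * x ∈ p → x ∈ p}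

/-- `I` is a right ideal of `R`, given as a set. -/
def IsRightIdealSet {R : Type u} [Ring R] (I : Set R) : Prop :=
  (0 : R) ∈ I ∧ (∀ x ∈ I, ∀ y ∈ I, x + y ∈ I) ∧ ∀ x ∈ I, ∀ r : R, x * r ∈ I

/-- The left singular ideal `ζ_l(R, a)` of `R` over `a`. -/
def leftSingularOver {R : Type u} [Ring R] (a : Set R) : Set R :=
  {r : R | ∃ I : Submodule R R, EssIdeal I ∧ a ⊆ I ∧ ∀ x ∈ I, x * r = 0}

section helpers

/-- `S` is a multiplicatively closed set, mapped to units, with left fractions. -/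
def Loc {R : Type u} [Ring R] (S : Set R) {Q : Type u} [Ring Q] (f : R →+* Q) : Prop :=
  (1 : R) ∈ S ∧ (∀ a ∈ S, ∀ b ∈ S, a * b ∈ S) ∧ (∀ s ∈ S, IsUnit (f s)) ∧
  ∀ q : Q, ∃ s ∈ S, ∃ r : R, f s * q = f r

theorem Loc.ore {R Q : Type u} [Ring R] [Ring Q] {S : Set R} {f : R →+* Q} (h : Loc S f)
    (r s : R) (hs : IsUnit (f s)) : ∃ t ∈ S, ∃ w, f t * f r = f w * f s := by
  obtain ⟨u, hu⟩ := hs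
  obtain ⟨t, ht, w, hw⟩ := h.2.2.2 (f r * (↑u⁻¹ : Q))
  refine ⟨t, ht, w, ?_⟩
  rw [← hw, ← hu]
  simp [mul_assoc]

theorem Loc.of_isLeftLoc {R Q : Type u} [Ring R] [Ring Q] {S : Set R} {f : R →+* Q}
    (h1 : (1 : R) ∈ S) (hm : ∀ a ∈ S, ∀ b ∈ S, a * b ∈ S) (h : IsLeftLoc S f) : Loc S f :=
  ⟨h1, hm, h.1, h.2.1⟩

theorem isUnit_of_lreg {Q : Type u} [Ring Q] [IsArtinianRing Q] {c : Q}
    (h : ∀ x, x * c = 0 → x = 0) : IsUnit c := by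
  rw [IsArtinianRing.isUnit_iff_isRightRegular]
  intro x y hxy
  have : (x - y) * c = 0 := by rw [sub_mul]; exact sub_eq_zero.2 hxy
  exact sub_eq_zero.1 (h _ this)

theorem Loc.isUnit_of_lreg {R Q : Type u} [Ring R] [Ring Q] [IsArtinianRing Q]
    {S : Set R} {f : R →+* Q} (h : Loc S f) {c : R}
    (hc : ∀ x, f (x * c) = 0 → f x = 0) : IsUnit (f c) := by
  apply Bavula.isUnit_of_lreg
  intro q hq
  obtain ⟨s, hs, r, hr⟩ := h.2.2.2 q
  have h1 : f (r * c) = 0 := by rw [map_mul, ← hr, mul_assoc, hq, mul_zero]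
  have h2 := hc r h1
  rw [h2] at hr
  exact (h.2.2.1 s hs).mul_right_eq_zero.1 hr

theorem IsIdealSet.neg {R : Type u} [Ring R] {a : Set R} (h : IsIdealSet a) {x : R}
    (hx : x ∈ a) : -x ∈ a := by
  simpa using (h.2.2 (-1) x hx).1

theorem IsIdealSet.sub {R : Type u} [Ring R] {a : Set R} (h : IsIdealSet a) {x y : R}
    (hx : x ∈ a) (hy : y ∈ a) : x - y ∈ a := by
  rw [sub_eq_add_neg]; exact h.2.1 _ hx _ (h.neg hy)

theorem IsIdealSet.sum {R : Type u} [Ring R] {a : Set R} (h : IsIdealSet a) {ι : Type*}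
    (s : Finset ι) (g : ι → R) (hg : ∀ i ∈ s, g i ∈ a) : ∑ i ∈ s, g i ∈ a := by
  classical
  induction s using Finset.induction_on with
  | empty => simpa using h.1
  | insert i s hi ih =>
    rw [Finset.sum_insert hi]
    exact h.2.1 _ (hg _ (by simp)) _ (ih fun j hj => hg j (by simp [hj]))

theorem isIdealSet_ker {R Q : Type u} [Ring R] [Ring Q] (f : R →+* Q) :
    IsIdealSet {r | f r = 0} := by
  refine ⟨by simp, ?_, ?_⟩
  · intro x hx y hy; simp only [Set.mem_ofPred_eq] at *; simp [hx, hy]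
  · intro r x hx; simp only [Set.mem_ofPred_eq] at *; simp [hx]

/-- In a simple Artinian left localization, an ideal that is not killed contains a denominator. -/
theorem Loc.exists_unit {R Q : Type u} [Ring R] [Ring Q] (hQ : SimpleArtinianRing Q)
    {S : Set R} {f : R →+* Q} (h : Loc S f) {I : Set R} (hI : IsIdealSet I)
    {x0 : R} (hx0 : x0 ∈ I) (hf : f x0 ≠ 0) : ∃ x ∈ I, ∃ s ∈ S, f x = f s := by
  have := hQ.2
  let K : Submodule Q Q :=
    { carrier := {q | ∃ s ∈ S, ∃ x ∈ I, f s * q = f x}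
      zero_mem' := ⟨1, h.1, 0, hI.1, by simp⟩
      add_mem' := by
        rintro a b ⟨s1, hs1, x1, hx1, e1⟩ ⟨s2, hs2, x2, hx2, e2⟩
        obtain ⟨t, ht, w, hw⟩ := h.ore s1 s2 (h.2.2.1 _ hs2)
        refine ⟨t * s1, h.2.1 _ ht _ hs1, t * x1 + w * x2,
          hI.2.1 _ (hI.2.2 _ _ hx1).1 _ (hI.2.2 _ _ hx2).1, ?_⟩
        rw [mul_add, map_add, map_mul, map_mul, map_mul, mul_assoc, e1, hw, mul_assoc, e2]
      smul_mem' := by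
        rintro q a ⟨s, hs, x, hx, e⟩
        obtain ⟨u, hu⟩ := h.2.2.1 _ hs
        obtain ⟨t, ht, w, hw⟩ := h.2.2.2 (q * (↑u⁻¹ : Q))
        refine ⟨t, ht, w * x, (hI.2.2 _ _ hx).1, ?_⟩
        rw [map_mul, ← hw, ← e, ← hu, smul_eq_mul]
        simp [mul_assoc] }
  have hKr : ∀ k ∈ K, ∀ r : R, k * f r ∈ K := by
    rintro k ⟨s, hs, x, hx, e⟩ r
    exact ⟨s, hs, x * r, (hI.2.2 _ _ hx).2, by rw [← mul_assoc, e, map_mul]⟩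
  have hKs : ∀ s ∈ S, ∀ k ∈ K, ∃ k' ∈ K, k' * f s = k := by
    intro s hs k hk
    let g : K →ₗ[Q] K :=
      { toFun := fun k => ⟨k.1 * f s, hKr _ k.2 _⟩
        map_add' := by intro a b; ext; simp [add_mul]
        map_smul' := by intro a b; ext; simp [mul_assoc] }
    have hg : Function.Injective g := by
      intro a b hab
      have : a.1 * f s = b.1 * f s := congrArg Subtype.val hab
      exact Subtype.ext ((h.2.2.1 s hs).mul_left_injective this)
    obtain ⟨k', hk'⟩ := (IsArtinian.bijective_of_injective_endomorphism g hg).2 ⟨k, hk⟩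
    exact ⟨k'.1, k'.2, congrArg Subtype.val hk'⟩
  have hKI : IsIdealSet (K : Set Q) := by
    refine ⟨K.zero_mem, fun x hx y hy => K.add_mem hx hy, fun q k hk => ⟨K.smul_mem q hk, ?_⟩⟩
    obtain ⟨s, hs, r, e⟩ := h.2.2.2 q
    obtain ⟨k', hk', e'⟩ := hKs s hs k hk
    rw [← e', mul_assoc, e]
    exact hKr _ hk' _
  rcases hQ.1.2 _ hKI with h0 | h1
  · exfalso
    have : f x0 ∈ (K : Set Q) := ⟨1, h.1, x0, hx0, by simp⟩
    rw [h0] at this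
    exact hf this
  · have : (1 : Q) ∈ (K : Set Q) := by rw [h1]; trivial
    obtain ⟨s, hs, x, hx, e⟩ := this
    exact ⟨x, hx, s, hs, by rw [← e, mul_one]⟩

theorem Loc.prime_ker {R Q : Type u} [Ring R] [Ring Q] (hQ : SimpleArtinianRing Q)
    {S : Set R} {f : R →+* Q} (h : Loc S f) : IsPrimeIdealSet {r | f r = 0} := by
  refine ⟨isIdealSet_ker f, ?_, ?_⟩
  · intro h1
    have : (1 : R) ∈ {r | f r = 0} := by rw [h1]; trivial
    exact hQ.1.1 (by simpa using this.symm)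
  · intro x y hxy
    by_contra! hcon
    have hI : IsIdealSet {z | ∀ r, f (x * r * z) = 0} := by
      refine ⟨by simp, ?_, ?_⟩
      · intro a ha b hb r; rw [mul_add, map_add, ha, hb, add_zero]
      · intro r z hz
        refine ⟨fun t => ?_, fun t => ?_⟩
        · have := hz (t * r); rwa [← mul_assoc] at this ⊢
        · rw [← mul_assoc, map_mul, hz, zero_mul]
    obtain ⟨z, hz, s, hs, e⟩ := h.exists_unit hQ hI hxy hcon.2
    have := hz 1
    rw [mul_one, map_mul, e] at this
    exact hcon.1 ((h.2.2.1 s hs).mul_left_eq_zero.1 this)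

/-- A finite intersection of ideals inside a prime. -/
theorem exists_le_of_inter {R : Type u} [Ring R] {ι : Type*} (s : Finset ι) (I : ι → Set R)
    (hI : ∀ i, IsIdealSet (I i)) {q : Set R} (hq : IsPrimeIdealSet q)
    (h : ∀ x, (∀ i ∈ s, x ∈ I i) → x ∈ q) : ∃ i ∈ s, I i ⊆ q := by
  classical
  induction s using Finset.induction_on with
  | empty =>
    exact absurd (Set.eq_univ_of_forall fun x => h x (by simp)) hq.2.1
  | insert i s hi ih =>
    by_cases hiq : I i ⊆ q
    · exact ⟨i, by simp, hiq⟩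
    · obtain ⟨x, hx, hxq⟩ := Set.not_subset.1 hiq
      obtain ⟨j, hj, hjq⟩ := ih (fun y hy => by
        refine (hq.2.2 x y fun r => h _ ?_).resolve_left hxq
        intro j hj
        rcases Finset.mem_insert.1 hj with rfl | hj
        · rw [mul_assoc]; exact ((hI j).2.2 _ _ hx).2
        · exact ((hI j).2.2 _ _ (hy j hj)).1)
      exact ⟨j, by simp [hj], hjq⟩

/-- Uniqueness of left localizations. -/
theorem IsLeftLoc.unique {R Q Q' : Type u} [Ring R] [Ring Q] [Ring Q'] {S : Set R}
    {f : R →+* Q} {g : R →+* Q'} (h1 : (1 : R) ∈ S) (hm : ∀ a ∈ S, ∀ b ∈ S, a * b ∈ S)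
    (hf : IsLeftLoc S f) (hg : IsLeftLoc S g) : Nonempty (Q ≃+* Q') := by
  have lf := Loc.of_isLeftLoc h1 hm hf
  have key0 : ∀ a b, f a = f b ↔ g a = g b := by
    intro a b
    rw [← sub_eq_zero, ← map_sub, hf.2.2, ← hg.2.2, map_sub, sub_eq_zero]
  let P : Q → Q' → Prop := fun q q' => ∃ s ∈ S, ∃ r, f s * q = f r ∧ g s * q' = g r
  have tot : ∀ q, ∃ q', P q q' := by
    intro q
    obtain ⟨s, hs, r, e⟩ := hf.2.1 q
    obtain ⟨u, hu⟩ := hg.1 s hs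
    exact ⟨(↑u⁻¹ : Q') * g r, s, hs, r, e, by rw [← hu]; simp⟩
  have tot' : ∀ q', ∃ q, P q q' := by
    intro q
    obtain ⟨s, hs, r, e⟩ := hg.2.1 q
    obtain ⟨u, hu⟩ := hf.1 s hs
    exact ⟨(↑u⁻¹ : Q) * f r, s, hs, r, by rw [← hu]; simp, e⟩
  have key : ∀ q q', P q q' → ∀ a b, f a * q = f b ↔ g a * q' = g b := by
    rintro q q' ⟨s, hs, r, e, e'⟩ a b
    obtain ⟨t, ht, w, hw⟩ := lf.ore a s (hf.1 s hs)
    have hw' : g t * g a = g w * g s := by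
      rw [← map_mul, ← map_mul, ← key0, map_mul, map_mul, hw]
    have c1 : f a * q = f b ↔ f (w * r) = f (t * b) := by
      rw [map_mul, map_mul, ← e, ← mul_assoc, ← hw, mul_assoc]
      exact (hf.1 t ht).mul_right_inj.symm
    have c2 : g a * q' = g b ↔ g (w * r) = g (t * b) := by
      rw [map_mul, map_mul, ← e', ← mul_assoc, ← hw', mul_assoc]
      exact (hg.1 t ht).mul_right_inj.symm
    rw [c1, c2, key0]
  have fun1 : ∀ q a b, P q a → P q b → a = b := by
    rintro q a b ha ⟨s, hs, r, e, e'⟩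
    have := (key q a ha s r).1 e
    exact (hg.1 s hs).mul_right_inj.1 (this.trans e'.symm)
  have fun2 : ∀ q a b, P a q → P b q → a = b := by
    rintro q a b ha ⟨s, hs, r, e, e'⟩
    have := (key a q ha s r).2 e'
    exact (hf.1 s hs).mul_right_inj.1 (this.trans e.symm)
  have Pmul : ∀ q u q' u', P q q' → P u u' → P (q * u) (q' * u') := by
    rintro q u q' u' ⟨s, hs, r, e, e'⟩ ⟨s2, hs2, r2, e2, e2'⟩
    obtain ⟨t, ht, w, hw⟩ := lf.ore r s2 (hf.1 s2 hs2)
    have hw' : g t * g r = g w * g s2 := by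
      rw [← map_mul, ← map_mul, ← key0, map_mul, map_mul, hw]
    refine ⟨t * s, hm _ ht _ hs, w * r2, ?_, ?_⟩
    · rw [map_mul, map_mul, ← e2, ← mul_assoc (f w), ← hw, ← e]; simp only [mul_assoc]
    · rw [map_mul, map_mul, ← e2', ← mul_assoc (g w), ← hw', ← e']; simp only [mul_assoc]
  have Padd : ∀ q u q' u', P q q' → P u u' → P (q + u) (q' + u') := by
    rintro q u q' u' ⟨s, hs, r, e, e'⟩ ⟨s2, hs2, r2, e2, e2'⟩
    obtain ⟨t, ht, w, hw⟩ := lf.ore s s2 (hf.1 s2 hs2)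
    have hw' : g t * g s = g w * g s2 := by
      rw [← map_mul, ← map_mul, ← key0, map_mul, map_mul, hw]
    refine ⟨t * s, hm _ ht _ hs, t * r + w * r2, ?_, ?_⟩
    · rw [map_add, map_mul, map_mul, map_mul, ← e2, ← mul_assoc (f w), ← hw, ← e]
      simp only [mul_assoc, mul_add]
    · rw [map_add, map_mul, map_mul, map_mul, ← e2', ← mul_assoc (g w), ← hw', ← e']
      simp only [mul_assoc, mul_add]
  choose φ hφ using tot
  choose ψ hψ using tot'
  exact ⟨{ toFun := φ
           invFun := ψ
           left_inv := fun q => fun2 _ _ _ (hψ _) (hφ _)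
           right_inv := fun q => fun1 _ _ _ (hφ _) (hψ _)
           map_mul' := fun a b => fun1 _ _ _ (hφ _) (Pmul _ _ _ _ (hφ _) (hφ _))
           map_add' := fun a b => fun1 _ _ _ (hφ _) (Padd _ _ _ _ (hφ _) (hφ _)) }⟩

theorem SimpleRing.of_equiv {A B : Type u} [Ring A] [Ring B] (e : A ≃+* B) (h : SimpleRing A) :
    SimpleRing B := by
  refine ⟨fun h01 => h.1 (e.injective (by simpa using h01)), fun a ha => ?_⟩
  have hI : IsIdealSet (e ⁻¹' a) := by
    refine ⟨by simpa using ha.1, fun x hx y hy => ?_, fun r x hx => ?_⟩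
    · simpa using ha.2.1 _ hx _ hy
    · simpa using ha.2.2 (e r) _ hx
  rcases h.2 _ hI with h0 | h1
  · left
    ext b
    have : e.symm b ∈ e ⁻¹' a ↔ e.symm b ∈ ({0} : Set A) := by rw [h0]
    simpa using this
  · right
    ext b
    have : e.symm b ∈ e ⁻¹' a ↔ e.symm b ∈ (Set.univ : Set A) := by rw [h1]
    simpa using this

theorem SimpleArtinianRing.of_equiv {A B : Type u} [Ring A] [Ring B] (e : A ≃+* B)
    (h : SimpleArtinianRing A) : SimpleArtinianRing B := by
  have := h.2
  exact ⟨h.1.of_equiv e, e.isArtinianRing⟩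

theorem SimpleRing.isSimpleRing {A : Type u} [Ring A] (h : SimpleRing A) : IsSimpleRing A := by
  have : Nontrivial A := ⟨0, 1, h.1⟩
  refine ⟨⟨fun I => ?_⟩⟩
  have hI : IsIdealSet (I : Set A) :=
    ⟨I.zero_mem, fun x hx y hy => I.add_mem hx hy,
      fun r x hx => ⟨I.mul_mem_left _ _ hx, I.mul_mem_right _ _ hx⟩⟩
  rcases h.2 _ hI with h0 | h1
  · left; apply SetLike.coe_injective; rw [h0]; ext x; simp [TwoSidedIdeal.mem_bot]
  · right; apply SetLike.coe_injective; rw [h1]; ext x; simp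

theorem simpleRing_of_isSimpleRing {A : Type u} [Ring A] [IsSimpleRing A] : SimpleRing A := by
  refine ⟨zero_ne_one, fun a ha => ?_⟩
  let I : TwoSidedIdeal A := TwoSidedIdeal.mk' a ha.1 (fun hx hy => ha.2.1 _ hx _ hy)
    (fun hx => ha.neg hx) (fun hy => (ha.2.2 _ _ hy).1) (fun hx => (ha.2.2 _ _ hx).2)
  have hm : ∀ x, x ∈ I ↔ x ∈ a := fun x => TwoSidedIdeal.mem_mk' ..
  rcases eq_bot_or_eq_top I with h0 | h1
  · left; ext x; rw [← hm, h0]; simp [TwoSidedIdeal.mem_bot]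
  · right; ext x; rw [← hm, h1]; simp

theorem SimpleArtinianRing.isSemisimpleRing {A : Type u} [Ring A] (h : SimpleArtinianRing A) :
    IsSemisimpleRing A := by
  have := h.1.isSimpleRing
  have := h.2
  infer_instance

/-- Decomposition of a semisimple ring. -/
theorem exists_decomp (Q : Type u) [Ring Q] [IsSemisimpleRing Q] :
    ∃ (n : ℕ) (A : Fin n → Type u) (_ : ∀ i, Ring (A i)),
      (∀ i, SimpleArtinianRing (A i)) ∧ Nonempty (Q ≃+* ∀ i, A i) := by
  obtain ⟨n, D, d, hD, hd, ⟨e⟩⟩ := IsSemisimpleRing.exists_ringEquiv_pi_matrix_divisionRing Q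
  refine ⟨n, fun i => Matrix (Fin (d i)) (Fin (d i)) (D i), fun i => inferInstance, fun i => ?_, ⟨e⟩⟩
  have := hd i
  exact ⟨simpleRing_of_isSimpleRing, inferInstance⟩

theorem mulClosed_regMod {R : Type u} [Ring R] (p : Set R) :
    (1 : R) ∈ regMod p ∧ ∀ a ∈ regMod p, ∀ b ∈ regMod p, a * b ∈ regMod p := by
  refine ⟨⟨by simp, by simp⟩, ?_⟩
  rintro a ⟨ha1, ha2⟩ b ⟨hb1, hb2⟩
  refine ⟨fun x hx => ha1 _ (hb1 _ ?_), fun x hx => hb2 _ (ha2 _ ?_)⟩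
  · rwa [mul_assoc]
  · rwa [← mul_assoc]

theorem mulClosed_lReg (R : Type u) [Ring R] :
    (1 : R) ∈ lReg R ∧ ∀ a ∈ lReg R, ∀ b ∈ lReg R, a * b ∈ lReg R := by
  refine ⟨fun x hx => by simpa using hx, ?_⟩
  intro a ha b hb x hx
  exact ha _ (hb _ (by rwa [mul_assoc]))

theorem zero_notMem_lReg (R : Type u) [Ring R] [Nontrivial R] : (0 : R) ∉ lReg R :=
  fun h => one_ne_zero (h 1 (by simp))

theorem IsLeftLoc.isLeftDenom {R Q : Type u} [Ring R] [Ring Q] {S : Set R} {f : R →+* Q}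
    (h1 : (1 : R) ∈ S) (hm : ∀ a ∈ S, ∀ b ∈ S, a * b ∈ S) (h0 : (0 : R) ∉ S)
    (hf : IsLeftLoc S f) : IsLeftDenom S := by
  have lf := Loc.of_isLeftLoc h1 hm hf
  refine ⟨⟨⟨h1, hm, h0⟩, fun s hs r => ?_⟩, fun r s hs hrs => ?_⟩
  · obtain ⟨t, ht, w, hw⟩ := lf.ore r s (hf.1 s hs)
    have : f (t * r - w * s) = 0 := by rw [map_sub, map_mul, map_mul, hw, sub_self]
    obtain ⟨u, hu, e⟩ := (hf.2.2 _).1 this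
    refine ⟨u * t, hm _ hu _ ht, u * w, ?_⟩
    rw [mul_sub, sub_eq_zero] at e
    simpa only [mul_assoc] using e
  · have : f r * f s = 0 := by rw [← map_mul, hrs, map_zero]
    exact (hf.2.2 r).1 ((hf.1 s hs).mul_left_eq_zero.1 this)

theorem Loc.regMod_eq {R Q : Type u} [Ring R] [Ring Q] [IsArtinianRing Q] {S : Set R}
    {f : R →+* Q} (h : Loc S f) : regMod {r | f r = 0} = {c | IsUnit (f c)} := by
  ext c
  constructor
  · intro hc
    exact h.isUnit_of_lreg hc.1
  · intro hc
    have hc : IsUnit (f c) := hc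
    refine ⟨fun x hx => ?_, fun x hx => ?_⟩
    · have hx : f (x * c) = 0 := hx
      rw [map_mul] at hx
      exact hc.mul_left_eq_zero.1 hx
    · have hx : f (c * x) = 0 := hx
      rw [map_mul] at hx
      exact hc.mul_right_eq_zero.1 hx

/-- `ass S` is an ideal for a left denominator set `S`. -/
theorem IsLeftDenom.isIdealSet_ass {R : Type u} [Ring R] {S : Set R} (h : IsLeftDenom S) :
    IsIdealSet (ass S) := by
  refine ⟨⟨1, h.1.1.1, by simp⟩, ?_, ?_⟩
  · rintro x ⟨s, hs, e⟩ y ⟨t, ht, e'⟩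
    obtain ⟨s', hs', r', e2⟩ := h.1.2 t ht s
    refine ⟨s' * s, h.1.1.2.1 _ hs' _ hs, ?_⟩
    rw [mul_add, mul_assoc, e, e2, mul_assoc, e']; simp
  · rintro r x ⟨s, hs, e⟩
    refine ⟨?_, ⟨s, hs, by rw [← mul_assoc, e, zero_mul]⟩⟩
    obtain ⟨s', hs', r', e2⟩ := h.1.2 s hs r
    exact ⟨s', hs', by rw [← mul_assoc, e2, mul_assoc, e, mul_zero]⟩

theorem IsLeftDenom.lreg_mod {R : Type u} [Ring R] {S : Set R} (h : IsLeftDenom S)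
    {s : R} (hs : s ∈ S) {x : R} (hx : x * s ∈ ass S) : x ∈ ass S := by
  obtain ⟨t, ht, e⟩ := hx
  obtain ⟨u, hu, e2⟩ := h.2 (t * x) s hs (by rw [mul_assoc, e])
  exact ⟨u * t, h.1.1.2.1 _ hu _ ht, by rw [mul_assoc, e2]⟩

section primes

/-- A prime over a semiprime ideal avoiding a given element. -/
theorem exists_prime_avoid {R : Type u} [Ring R] {a : Set R} (ha : IsSemiprimeIdealSet a)
    {x : R} (hx : x ∉ a) : ∃ p, IsPrimeIdealSet p ∧ a ⊆ p ∧ x ∉ p := by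
  have step : ∀ y : {y // y ∉ a}, ∃ z : {y // y ∉ a}, ∃ r, z.1 = y.1 * r * y.1 := by
    intro y
    by_contra! hcon
    refine y.2 (ha.2 _ fun r => ?_)
    by_contra hr
    exact hcon ⟨_, hr⟩ r rfl
  choose g ρ hg using step
  let m : ℕ → {y // y ∉ a} := fun k => Nat.rec ⟨x, hx⟩ (fun _ y => g y) k
  have hmS : ∀ k, (m (k+1)).1 = (m k).1 * ρ (m k) * (m k).1 := fun k => hg (m k)
  have hmono : ∀ (I : Set R), IsIdealSet I → ∀ k l, k ≤ l → (m k).1 ∈ I → (m l).1 ∈ I := by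
    intro I hI k l hkl hk
    induction l, hkl using Nat.le_induction with
    | base => exact hk
    | succ l _ ih => rw [hmS]; exact (hI.2.2 _ _ ih).1
  obtain ⟨p, hap, hmax⟩ := zorn_subset_nonempty
    {p : Set R | IsIdealSet p ∧ a ⊆ p ∧ ∀ k, (m k).1 ∉ p} (by
      intro c hc hch ⟨p0, hp0⟩
      refine ⟨⋃₀ c, ⟨⟨⟨p0, hp0, (hc hp0).1.1⟩, ?_, ?_⟩, ?_, ?_⟩, fun s hs => Set.subset_sUnion_of_mem hs⟩
      · rintro y ⟨p1, hp1, hy⟩ z ⟨p2, hp2, hz⟩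
        rcases hch.total hp1 hp2 with h | h
        · exact ⟨p2, hp2, (hc hp2).1.2.1 _ (h hy) _ hz⟩
        · exact ⟨p1, hp1, (hc hp1).1.2.1 _ hy _ (h hz)⟩
      · rintro r y ⟨p1, hp1, hy⟩
        exact ⟨⟨p1, hp1, ((hc hp1).1.2.2 r y hy).1⟩, ⟨p1, hp1, ((hc hp1).1.2.2 r y hy).2⟩⟩
      · exact (hc hp0).2.1.trans (Set.subset_sUnion_of_mem hp0)
      · rintro k ⟨p1, hp1, hk⟩
        exact (hc hp1).2.2 k hk) a ⟨ha.1, subset_rfl, fun k => (m k).2⟩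
  have hp := hmax.prop
  have big : ∀ J, IsIdealSet J → p ⊆ J → ∀ y ∈ J, y ∉ p → ∃ k, (m k).1 ∈ J := by
    intro J hJ hpJ y hy hyp
    by_contra! hcon
    exact hyp (hmax.le_of_ge ⟨hJ, hap.trans hpJ, hcon⟩ hpJ hy)
  refine ⟨p, ⟨hp.1, ?_, ?_⟩, hap, hp.2.2 0⟩
  · intro h; exact hp.2.2 0 (by rw [h]; trivial)
  · intro y z hyz
    by_contra! hcon
    have hJ : IsIdealSet {w | ∀ r, w * r * z ∈ p} := by
      refine ⟨fun r => by simpa using hp.1.1, ?_, ?_⟩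
      · intro u hu v hv r; rw [add_mul, add_mul]; exact hp.1.2.1 _ (hu r) _ (hv r)
      · intro r u hu
        refine ⟨fun t => ?_, fun t => ?_⟩
        · rw [mul_assoc, mul_assoc, ← mul_assoc u]; exact (hp.1.2.2 _ _ (hu t)).1
        · rw [mul_assoc u]; exact hu _
    obtain ⟨k, hk⟩ := big _ hJ (fun w hw r => by
      rw [mul_assoc]; exact (hp.1.2.2 _ _ hw).2) y hyz hcon.1
    have hJ' : IsIdealSet {w | ∀ u, (∀ r, u * r * z ∈ p) → ∀ r, u * r * w ∈ p} := by
      refine ⟨fun u _ r => by simpa using hp.1.1, ?_, ?_⟩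
      · intro v hv w hw u hu r; rw [mul_add]; exact hp.1.2.1 _ (hv u hu r) _ (hw u hu r)
      · intro r w hw
        refine ⟨fun u hu t => ?_, fun u hu t => ?_⟩
        · rw [← mul_assoc, mul_assoc u]; exact hw u hu _
        · rw [← mul_assoc]; exact (hp.1.2.2 _ _ (hw u hu t)).2
    obtain ⟨l, hl⟩ := big _ hJ' (fun w hw u _ r => (hp.1.2.2 _ _ hw).1) z
      (fun u hu r => hu r) hcon.2
    have h1 := hmono _ hJ k (max k l) (le_max_left _ _) hk
    have h2 := hmono _ hJ' l (max k l) (le_max_right _ _) hl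
    apply hp.2.2 (max k l + 1)
    rw [hmS]
    exact h2 _ h1 _

theorem exists_minPrime_le {R : Type u} [Ring R] {a p : Set R} (hp : IsPrimeIdealSet p)
    (hap : a ⊆ p) : ∃ q ∈ minPrimesOver a, q ⊆ p := by
  obtain ⟨q, hqp, hmin⟩ := zorn_superset_nonempty
    {p : Set R | IsPrimeIdealSet p ∧ a ⊆ p} (by
      intro c hc hch ⟨p0, hp0⟩
      refine ⟨⋂₀ c, ⟨⟨⟨?_, ?_, ?_⟩, ?_, ?_⟩, ?_⟩, fun s hs => Set.sInter_subset_of_mem hs⟩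
      · exact fun q hq => (hc hq).1.1.1
      · exact fun x hx y hy q hq => (hc hq).1.1.2.1 _ (hx q hq) _ (hy q hq)
      · exact fun r x hx => ⟨fun q hq => ((hc hq).1.1.2.2 r x (hx q hq)).1,
          fun q hq => ((hc hq).1.1.2.2 r x (hx q hq)).2⟩
      · intro h
        apply (hc hp0).1.2.1
        apply Set.eq_univ_of_univ_subset
        rw [← h]
        exact Set.sInter_subset_of_mem hp0
      · intro x y hxy
        by_contra! hcon
        obtain ⟨h1, h2⟩ := hcon
        simp only [Set.mem_sInter, not_forall] at h1 h2
        obtain ⟨p1, hp1, h1⟩ := h1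
        obtain ⟨p2, hp2, h2⟩ := h2
        rcases hch.total hp1 hp2 with h | h
        · rcases (hc hp1).1.2.2 x y (fun r => hxy r _ hp1) with h3 | h3
          · exact h1 h3
          · exact h2 (h h3)
        · rcases (hc hp2).1.2.2 x y (fun r => hxy r _ hp2) with h3 | h3
          · exact h1 (h h3)
          · exact h2 h3
      · exact fun x hx q hq => (hc hq).2 hx) p ⟨hp, hap⟩
  exact ⟨q, ⟨hmin.prop.1, hmin.prop.2, fun q' h1 h2 h3 =>
    Set.Subset.antisymm h3 (hmin.le_of_le ⟨h1, h2⟩ h3)⟩, hqp⟩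

theorem mem_of_forall_minPrimes {R : Type u} [Ring R] {a : Set R} (ha : IsSemiprimeIdealSet a)
    {x : R} (hx : ∀ p ∈ minPrimesOver a, x ∈ p) : x ∈ a := by
  by_contra hxa
  obtain ⟨p, hp, hap, hxp⟩ := exists_prime_avoid ha hxa
  obtain ⟨q, hq, hqp⟩ := exists_minPrime_le hp hap
  exact hxp (hqp (hx q hq))

end primes

theorem prod_isLeftLoc {R : Type u} [Ring R] {C : Set R}
    (hC1 : (1 : R) ∈ C)
    (ha : IsSemiprimeIdealSet (ass C)) (hfin : (minPrimesOver (ass C)).Finite)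
    (Qp : ↥(minPrimesOver (ass C)) → Type u) [∀ p, Ring (Qp p)]
    (fp : ∀ p : ↥(minPrimesOver (ass C)), R →+* Qp p)
    (hQ : ∀ p, SimpleArtinianRing (Qp p))
    (hloc : ∀ p, IsLeftLoc (regMod p.1) (fp p))
    (hass : ∀ p ∈ minPrimesOver (ass C), ass (regMod p) = p)
    {Rb : Type u} [Ring Rb] {π : R →+* Rb} (hπ : IsQuotBy (ass C) π)
    (hreg : π '' C ⊆ reg Rb) (hd : DenseIn (π '' C) (reg Rb)) :
    IsLeftLoc C (RingHom.pi fp) := by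
  classical
  have := hfin.to_subtype
  have := Fintype.ofFinite ↥(minPrimesOver (ass C))
  have hart : ∀ p, IsArtinianRing (Qp p) := fun p => (hQ p).2
  have hss : ∀ p, IsSemisimpleRing (Qp p) := fun p => (hQ p).isSemisimpleRing
  have hl : ∀ p, Loc (regMod p.1) (fp p) := fun p =>
    Loc.of_isLeftLoc (mulClosed_regMod _).1 (mulClosed_regMod _).2 (hloc p)
  have hker : ∀ p r, fp p r = 0 ↔ r ∈ p.1 := fun p r => by rw [(hloc p).2.2, hass _ p.2]
  have hker' : ∀ r, RingHom.pi fp r = 0 ↔ r ∈ ass C := by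
    intro r
    constructor
    · intro h
      refine mem_of_forall_minPrimes ha fun p hp => ?_
      exact (hker ⟨p, hp⟩ r).1 (congrFun h ⟨p, hp⟩)
    · intro h
      funext p
      exact (hker p r).2 (p.2.2.1 h)
  -- separating elements
  have hsep : ∀ i, ∃ x, IsUnit (fp i x) ∧ ∀ j, j ≠ i → fp j x = 0 := by
    intro i
    have hI : IsIdealSet {x | ∀ j, j ≠ i → x ∈ j.1} := by
      refine ⟨fun j _ => j.2.1.1.1, fun x hx y hy j hj => j.2.1.1.2.1 _ (hx j hj) _ (hy j hj),
        fun r x hx => ⟨fun j hj => (j.2.1.1.2.2 _ _ (hx j hj)).1,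
          fun j hj => (j.2.1.1.2.2 _ _ (hx j hj)).2⟩⟩
    have hne : ∃ x0, (∀ j, j ≠ i → x0 ∈ j.1) ∧ x0 ∉ i.1 := by
      by_contra! hcon
      obtain ⟨j, hj, hji⟩ := exists_le_of_inter (Finset.univ.erase i) (fun j => j.1)
        (fun j => j.2.1.1) i.2.1 (fun x hx => hcon x fun j hj => hx j (by simp [hj]))
      have := i.2.2.2 _ j.2.1 j.2.2.1 hji
      exact (Finset.mem_erase.1 hj).1 (Subtype.ext this)
    obtain ⟨x0, h1, h2⟩ := hne
    obtain ⟨x, hx, s, hs, e⟩ := (hl i).exists_unit (hQ i) hI h1 (fun h => h2 ((hker _ _).1 h))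
    exact ⟨x, by rw [e]; exact (hloc i).1 s hs, fun j hj => (hker _ _).2 (hx j hj)⟩
  choose x hx hx0 using hsep
  have hsum : ∀ (y : ↥(minPrimesOver (ass C)) → R) j,
      fp j (∑ i, x i * y i) = fp j (x j) * fp j (y j) := by
    intro y j
    rw [map_sum, Finset.sum_eq_single j]
    · rw [map_mul]
    · intro i _ hij; rw [map_mul, hx0 i j (Ne.symm hij), zero_mul]
    · simp
  -- fractions with regular denominators
  have hfrac : ∀ q : (∀ p, Qp p), ∃ t r, IsUnit (RingHom.pi fp t) ∧
      RingHom.pi fp t * q = RingHom.pi fp r := by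
    intro q
    have : ∀ i, ∃ s ∈ regMod i.1, ∃ r, fp i s * q i = fp i r := fun i => (hloc i).2.1 (q i)
    choose s hs r hr using this
    refine ⟨∑ i, x i * s i, ∑ i, x i * r i, ?_, ?_⟩
    · rw [Pi.isUnit_iff]
      intro j
      change IsUnit (fp j _)
      rw [hsum]
      exact (hx j).mul ((hloc j).1 _ (hs j))
    · funext j
      change fp j _ * q j = fp j _
      rw [hsum, hsum, mul_assoc, hr]
  have hπk : ∀ r, π r = 0 ↔ RingHom.pi fp r = 0 := fun r => by rw [hker', hπ.2]
  have hunit : ∀ c, π c ∈ lReg Rb → IsUnit (RingHom.pi fp c) := by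
    intro c hc
    apply isUnit_of_lreg
    intro q hq
    obtain ⟨t, r, ht, e⟩ := hfrac q
    have h1 : RingHom.pi fp (r * c) = 0 := by rw [map_mul, ← e, mul_assoc, hq, mul_zero]
    rw [← hπk, map_mul] at h1
    have h2 := (hπk r).1 (hc _ h1)
    rw [h2] at e
    exact ht.mul_right_eq_zero.1 e
  refine ⟨fun c hc => hunit c (hreg ⟨c, hc, rfl⟩).1, fun q => ?_, hker'⟩
  obtain ⟨t, r, ht, e⟩ := hfrac q
  have htr : π t ∈ reg Rb := by
    constructor
    · intro y hy
      obtain ⟨y, rfl⟩ := hπ.1 y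
      rw [← map_mul, hπk, map_mul] at hy
      exact (hπk y).2 (ht.mul_left_eq_zero.1 hy)
    · intro y hy
      obtain ⟨y, rfl⟩ := hπ.1 y
      rw [← map_mul, hπk, map_mul] at hy
      exact (hπk y).2 (ht.mul_right_eq_zero.1 hy)
  obtain ⟨w, c, hc, hw⟩ := hd _ htr
  obtain ⟨w, rfl⟩ := hπ.1 w
  have h1 : RingHom.pi fp (c - w * t) = 0 := by
    rw [← hπk, map_sub, hw, map_mul, sub_self]
  rw [map_sub, sub_eq_zero] at h1
  refine ⟨c, hc, w * r, ?_⟩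
  rw [h1, map_mul, map_mul, mul_assoc, e]

/-- Condition (d) holds for every model of `R/a`. -/
theorem cond_d {R : Type u} [Ring R] {C : Set R} {Q : Type u} [Ring Q] [IsArtinianRing Q]
    {f : R →+* Q} (hf : IsLeftLoc C f) {Rb : Type u} [Ring Rb] {π : R →+* Rb}
    (hπ : IsQuotBy (ass C) π) : π '' C ⊆ reg Rb ∧ DenseIn (π '' C) (reg Rb) := by
  have hπk : ∀ r, π r = 0 ↔ f r = 0 := fun r => by rw [hf.2.2, hπ.2]
  constructor
  · rintro _ ⟨c, hc, rfl⟩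
    constructor
    · intro y hy
      obtain ⟨y, rfl⟩ := hπ.1 y
      rw [← map_mul, hπk, map_mul] at hy
      exact (hπk y).2 ((hf.1 c hc).mul_left_eq_zero.1 hy)
    · intro y hy
      obtain ⟨y, rfl⟩ := hπ.1 y
      rw [← map_mul, hπk, map_mul] at hy
      exact (hπk y).2 ((hf.1 c hc).mul_right_eq_zero.1 hy)
  · intro t ht
    obtain ⟨t, rfl⟩ := hπ.1 t
    have hu : IsUnit (f t) := by
      apply isUnit_of_lreg
      intro q hq
      obtain ⟨s, hs, r, e⟩ := hf.2.1 q
      have h1 : f (r * t) = 0 := by rw [map_mul, ← e, mul_assoc, hq, mul_zero]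
      rw [← hπk, map_mul] at h1
      have h2 := (hπk r).1 (ht.1 _ h1)
      rw [h2] at e
      exact (hf.1 s hs).mul_right_eq_zero.1 e
    obtain ⟨u, hu⟩ := hu
    obtain ⟨c, hc, w, e⟩ := hf.2.1 (↑u⁻¹ : Q)
    refine ⟨π w, c, hc, ?_⟩
    have : f (c - w * t) = 0 := by
      rw [map_sub, map_mul, ← e, ← hu]; simp [mul_assoc]
    rw [← hπk, map_sub, map_mul, sub_eq_zero] at this
    exact this

theorem comp_isLeftLoc {R : Type u} [Ring R] {C : Set R} {Q : Type u} [Ring Q]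
    {Rb : Type u} [Ring Rb] {π : R →+* Rb} (hπ : IsQuotBy (ass C) π)
    (hreg : π '' C ⊆ reg Rb) (hd : DenseIn (π '' C) (reg Rb))
    {f : Rb →+* Q} (hf : IsLeftLoc (reg Rb) f) : IsLeftLoc C (f.comp π) := by
  refine ⟨fun c hc => hf.1 _ (hreg ⟨c, hc, rfl⟩), fun q => ?_, fun r => ?_⟩
  · obtain ⟨t, ht, r, e⟩ := hf.2.1 q
    obtain ⟨w, c, hc, hw⟩ := hd t ht
    obtain ⟨r, rfl⟩ := hπ.1 r
    obtain ⟨w, rfl⟩ := hπ.1 w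
    refine ⟨c, hc, w * r, ?_⟩
    simp only [RingHom.comp_apply]
    rw [hw, map_mul, map_mul, map_mul, mul_assoc, e]
  · rw [← hπ.2, RingHom.comp_apply, hf.2.2]
    constructor
    · rintro ⟨s, hs, e⟩
      exact hs.2 _ e
    · intro h
      exact ⟨1, ⟨fun x hx => by simpa using hx, fun x hx => by simpa using hx⟩, by simp [h]⟩

/-- Existence of the quotient ring. -/
theorem exists_quot {R Q : Type u} [Ring R] [Ring Q] (f : R →+* Q) {a : Set R}
    (h : ∀ r, f r = 0 ↔ r ∈ a) : ∃ (Rb : Type u) (_ : Ring Rb) (π : R →+* Rb), IsQuotBy a π := by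
  refine ⟨f.range, inferInstance, f.rangeRestrict, f.rangeRestrict_surjective, fun r => ?_⟩
  rw [← h, Subtype.ext_iff]
  rfl

section decomposed

variable {R : Type u} [Ring R] {n : ℕ} {A : Fin n → Type u} [∀ i, Ring (A i)]

/-- The `i`-th component. -/
def pr (f : R →+* ∀ i, A i) (i : Fin n) : R →+* A i := (Pi.evalRingHom A i).comp f

theorem pr_loc {C : Set R} {f : R →+* ∀ i, A i} (h : Loc C f) (i : Fin n) : Loc C (pr f i) := by
  classical
  refine ⟨h.1, h.2.1, fun s hs => (Pi.isUnit_iff.1 (h.2.2.1 s hs)) i, fun q => ?_⟩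
  obtain ⟨s, hs, r, e⟩ := h.2.2.2 (Pi.single i q)
  refine ⟨s, hs, r, ?_⟩
  have := congrFun e i
  rw [Pi.mul_apply, Pi.single_eq_same] at this
  exact this

theorem pr_eq_zero {f : R →+* ∀ i, A i} {r : R} : f r = 0 ↔ ∀ i, pr f i r = 0 :=
  funext_iff

theorem pr_sep {C : Set R} {f : R →+* ∀ i, A i} (h : Loc C f) (i : Fin n) :
    ∃ r, IsUnit (pr f i r) ∧ ∀ j, j ≠ i → pr f j r = 0 := by
  classical
  obtain ⟨s, hs, r, e⟩ := h.2.2.2 (Pi.single i 1)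
  refine ⟨r, ?_, fun j hj => ?_⟩
  · have := congrFun e i
    rw [Pi.mul_apply, Pi.single_eq_same, mul_one] at this
    have h2 := (Pi.isUnit_iff.1 (h.2.2.1 s hs)) i
    rw [this] at h2
    exact h2
  · have := congrFun e j
    rw [Pi.mul_apply, Pi.single_eq_of_ne hj, mul_zero] at this
    exact this.symm

theorem minPrimes_eq (hA : ∀ i, SimpleArtinianRing (A i)) {C : Set R} {f : R →+* ∀ i, A i}
    (h : Loc C f) (hk : ∀ r, f r = 0 ↔ r ∈ ass C) :
    minPrimesOver (ass C) = Set.range fun i => {r | pr f i r = 0} := by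
  have hprime : ∀ i, IsPrimeIdealSet {r | pr f i r = 0} := fun i => (pr_loc h i).prime_ker (hA i)
  have hsub : ∀ i, ass C ⊆ {r | pr f i r = 0} := fun i r hr =>
    pr_eq_zero.1 ((hk r).2 hr) i
  have hbelow : ∀ q, IsPrimeIdealSet q → ass C ⊆ q → ∃ i, {r | pr f i r = 0} ⊆ q := by
    intro q hq haq
    obtain ⟨i, _, hi⟩ := exists_le_of_inter Finset.univ (fun i => {r | pr f i r = 0})
      (fun i => (hprime i).1) hq (fun x hx => haq ((hk x).1 (pr_eq_zero.2 fun i => hx i (by simp))))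
    exact ⟨i, hi⟩
  have hinc : ∀ i j, {r | pr f i r = 0} ⊆ {r | pr f j r = 0} → i = j := by
    intro i j hij
    by_contra hne
    obtain ⟨r, hr, hr0⟩ := pr_sep h j
    have h1 : pr f j r = 0 := hij (hr0 i hne)
    have := (hA j).1.1
    rw [h1, isUnit_zero_iff] at hr
    exact this hr
  ext q
  constructor
  · rintro ⟨hq, haq, hmin⟩
    obtain ⟨i, hi⟩ := hbelow q hq haq
    exact ⟨i, hmin _ (hprime i) (hsub i) hi⟩
  · rintro ⟨i, rfl⟩
    refine ⟨hprime i, hsub i, fun q hq haq hqi => ?_⟩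
    obtain ⟨j, hj⟩ := hbelow q hq haq
    have := hinc j i (hj.trans hqi)
    subst this
    exact Set.Subset.antisymm hqi hj

theorem pr_regMod (hA : ∀ i, SimpleArtinianRing (A i)) {C : Set R} {f : R →+* ∀ i, A i}
    (h : Loc C f) (i : Fin n) : regMod {r | pr f i r = 0} = {c | IsUnit (pr f i c)} := by
  have := (hA i).2
  exact (pr_loc h i).regMod_eq

theorem pr_ass (hA : ∀ i, SimpleArtinianRing (A i)) {C : Set R} {f : R →+* ∀ i, A i}
    (h : Loc C f) (hk : ∀ r, f r = 0 ↔ r ∈ ass C) (i : Fin n) :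
    ass (regMod {r | pr f i r = 0}) = {r | pr f i r = 0} := by
  rw [pr_regMod hA h]
  ext x
  constructor
  · rintro ⟨s, hs, e⟩
    have h1 : pr f i s * pr f i x = 0 := by rw [← map_mul, e, map_zero]
    exact (IsUnit.mul_right_eq_zero hs).1 h1
  · intro hx
    obtain ⟨r, hr, hr0⟩ := pr_sep h i
    have : f (r * x) = 0 := by
      rw [pr_eq_zero]
      intro j
      by_cases hj : j = i
      · subst hj; rw [map_mul, hx, mul_zero]
      · rw [map_mul, hr0 j hj, zero_mul]
    obtain ⟨c, hc, e⟩ := (hk _).1 this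
    refine ⟨c * r, ?_, by rw [mul_assoc, e]⟩
    change IsUnit (pr f i (c * r))
    rw [map_mul]
    exact ((pr_loc h i).2.2.1 c hc).mul hr

theorem pr_isLeftLoc (hA : ∀ i, SimpleArtinianRing (A i)) {C : Set R} {f : R →+* ∀ i, A i}
    (h : Loc C f) (hk : ∀ r, f r = 0 ↔ r ∈ ass C) (i : Fin n) :
    IsLeftLoc (regMod {r | pr f i r = 0}) (pr f i) := by
  refine ⟨?_, ?_, ?_⟩
  · rw [pr_regMod hA h]; exact fun s hs => hs
  · intro q
    obtain ⟨s, hs, r, e⟩ := (pr_loc h i).2.2.2 q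
    exact ⟨s, by rw [pr_regMod hA h]; exact (pr_loc h i).2.2.1 s hs, r, e⟩
  · rw [pr_ass hA h hk]; exact fun r => Iff.rfl

theorem zero_notMem_regMod {p : Set R} (hp : IsPrimeIdealSet p) : (0 : R) ∉ regMod p := by
  intro h
  exact hp.2.1 (Set.eq_univ_of_forall fun x => h.1 x (by simpa using hp.1.1))

theorem pr_isLeftDenom (hA : ∀ i, SimpleArtinianRing (A i)) {C : Set R} {f : R →+* ∀ i, A i}
    (h : Loc C f) (hk : ∀ r, f r = 0 ↔ r ∈ ass C) (i : Fin n) :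
    IsLeftDenom (regMod {r | pr f i r = 0}) :=
  (pr_isLeftLoc hA h hk i).isLeftDenom (mulClosed_regMod _).1 (mulClosed_regMod _).2
    (zero_notMem_regMod ((pr_loc h i).prime_ker (hA i)))

theorem semiprime_ass (hA : ∀ i, SimpleArtinianRing (A i)) {C : Set R} {f : R →+* ∀ i, A i}
    (h : Loc C f) (hk : ∀ r, f r = 0 ↔ r ∈ ass C) : IsSemiprimeIdealSet (ass C) := by
  have : ass C = {r | f r = 0} := by ext r; exact (hk r).symm
  rw [this]
  refine ⟨isIdealSet_ker f, fun x hx => ?_⟩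
  refine pr_eq_zero.2 fun i => ?_
  exact (or_self_iff.1 (((pr_loc h i).prime_ker (hA i)).2.2 x x fun r => pr_eq_zero.1 (hx r) i))

theorem pr_max (hA : ∀ i, SimpleArtinianRing (A i)) {C : Set R} {f : R →+* ∀ i, A i}
    (h : Loc C f) (hk : ∀ r, f r = 0 ↔ r ∈ ass C) (i : Fin n) :
    regMod {r | pr f i r = 0} ∈ maxLeftDenom R := by
  refine ⟨pr_isLeftDenom hA h hk i, fun T hT hST => Set.Subset.antisymm hST fun t ht => ?_⟩
  have hsub : {r | pr f i r = 0} ⊆ ass T := by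
    conv_lhs => rw [← pr_ass hA h hk i]
    rintro r ⟨s, hs, e⟩
    exact ⟨s, hST hs, e⟩
  have hass : ∀ x ∈ ass T, pr f i x = 0 := by
    intro x hx
    by_contra hne
    have hl := Loc.of_isLeftLoc (mulClosed_regMod _).1 (mulClosed_regMod _).2
      (pr_isLeftLoc hA h hk i)
    obtain ⟨y, hy, s, hs, e⟩ := hl.exists_unit (hA i) hT.isIdealSet_ass hx hne
    have hyT : y ∈ T := by
      apply hST
      rw [pr_regMod hA h] at hs ⊢
      change IsUnit (pr f i y)
      rw [e]; exact hs
    obtain ⟨u, hu, e2⟩ := hy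
    have := hT.1.1.2.1 _ hu _ hyT
    rw [e2] at this
    exact hT.1.1.2.2 this
  rw [pr_regMod hA h]
  have := (hA i).2
  exact (pr_loc h i).isUnit_of_lreg fun x hx => hass _ (hT.lreg_mod ht (hsub hx))

theorem exists_le_pr (hA : ∀ i, SimpleArtinianRing (A i)) {C : Set R} {f : R →+* ∀ i, A i}
    (h : Loc C f) (hk : ∀ r, f r = 0 ↔ r ∈ ass C) {S : Set R} (hS : IsLeftDenom S)
    (hCS : C ⊆ S) : ∃ i, S ⊆ regMod {r | pr f i r = 0} := by
  classical
  have haS : ass C ⊆ ass S := fun r ⟨s, hs, e⟩ => ⟨s, hCS hs, e⟩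
  have hI := hS.isIdealSet_ass
  choose r hr hr0 using pr_sep h
  have hex : ∃ i, ∀ x ∈ ass S, pr f i x = 0 := by
    by_contra! hcon
    have : ∀ i, ∃ x ∈ ass S, IsUnit (pr f i x) := by
      intro i
      obtain ⟨x, hx, hne⟩ := hcon i
      obtain ⟨y, hy, s, hs, e⟩ := (pr_loc h i).exists_unit (hA i) hI hx hne
      exact ⟨y, hy, by rw [e]; exact (pr_loc h i).2.2.1 s hs⟩
    choose x hx hxu using this
    have hy : ∑ i, r i * x i ∈ ass S := hI.sum _ _ fun i _ => (hI.2.2 _ _ (hx i)).1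
    have hyu : IsUnit (f (∑ i, r i * x i)) := by
      rw [Pi.isUnit_iff]
      intro j
      change IsUnit (pr f j _)
      rw [map_sum, Finset.sum_eq_single j]
      · rw [map_mul]; exact (hr j).mul (hxu j)
      · intro i _ hij; rw [map_mul, hr0 i j (Ne.symm hij), zero_mul]
      · simp
    obtain ⟨c, hc, w, e⟩ := h.ore 1 _ hyu
    have h0 : f (c - w * ∑ i, r i * x i) = 0 := by
      rw [map_sub, map_mul, ← e, map_one, mul_one, sub_self]
    have h1 := hI.2.1 _ (haS ((hk _).1 h0)) _ (hI.2.2 w _ hy).1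
    rw [sub_add_cancel] at h1
    obtain ⟨s, hs, e2⟩ := h1
    have := hS.1.1.2.1 _ hs _ (hCS hc)
    rw [e2] at this
    exact hS.1.1.2.2 this
  obtain ⟨i, hi⟩ := hex
  refine ⟨i, fun s hs => ?_⟩
  rw [pr_regMod hA h]
  have := (hA i).2
  refine (pr_loc h i).isUnit_of_lreg fun x hx => ?_
  have h0 : f (r i * x * s) = 0 := by
    rw [pr_eq_zero]
    intro j
    by_cases hj : j = i
    · subst hj; rw [mul_assoc, map_mul, hx, mul_zero]
    · rw [mul_assoc, map_mul, hr0 i j hj, zero_mul]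
  have h1 := hi _ (hS.lreg_mod hs (haS ((hk _).1 h0)))
  rw [map_mul] at h1
  exact (hr i).mul_right_eq_zero.1 h1

end decomposed

/-- Everything that follows from condition (1). -/
theorem forward {R : Type u} [Ring R] {C : Set R} (hC1 : (1 : R) ∈ C)
    (hCm : ∀ a ∈ C, ∀ b ∈ C, a * b ∈ C) {Q : Type u} [Ring Q] [IsSemisimpleRing Q]
    {f : R →+* Q} (hf : IsLeftLoc C f) :
    IsSemiprimeIdealSet (ass C) ∧
       (minPrimesOver (ass C)).Finite ∧
       (∀ p ∈ minPrimesOver (ass C),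
         IsLeftDenom (regMod p) ∧ ass (regMod p) = p) ∧
       (∀ p ∈ minPrimesOver (ass C),
         ∃ (Q : Type u) (_ : Ring Q) (f : R →+* Q),
           IsLeftLoc (regMod p) f ∧ SimpleArtinianRing Q) ∧
       ({S : Set R | S ∈ maxLeftDenom R ∧ C ⊆ S} =
        {S : Set R | ∃ p ∈ minPrimesOver (ass C), S = regMod p}) := by
  obtain ⟨n, A, hR, hA, ⟨e⟩⟩ := exists_decomp Q
  have hf' : IsLeftLoc C ((e : Q →+* ∀ i, A i).comp f) := by
    refine ⟨fun s hs => (hf.1 s hs).map (e : Q →+* ∀ i, A i), fun q => ?_, fun r => ?_⟩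
    · obtain ⟨s, hs, r, h⟩ := hf.2.1 (e.symm q)
      refine ⟨s, hs, r, ?_⟩
      have := congrArg e h
      simpa using this
    · rw [← hf.2.2]; simp
  have h := Loc.of_isLeftLoc hC1 hCm hf'
  have hk := hf'.2.2
  have hmin := minPrimes_eq hA h hk
  refine ⟨semiprime_ass hA h hk, ?_, ?_, ?_, ?_⟩
  · rw [hmin]; exact Set.finite_range _
  · rw [hmin]
    rintro _ ⟨i, rfl⟩
    exact ⟨pr_isLeftDenom hA h hk i, pr_ass hA h hk i⟩
  · rw [hmin]
    rintro _ ⟨i, rfl⟩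
    exact ⟨A i, hR i, _, pr_isLeftLoc hA h hk i, hA i⟩
  · rw [hmin]
    ext S
    constructor
    · rintro ⟨hS, hCS⟩
      obtain ⟨i, hi⟩ := exists_le_pr hA h hk hS.1 hCS
      exact ⟨_, ⟨i, rfl⟩, hS.2 _ (pr_isLeftDenom hA h hk i) hi⟩
    · rintro ⟨_, ⟨i, rfl⟩, rfl⟩
      refine ⟨pr_max hA h hk i, ?_⟩
      rw [pr_regMod hA h]
      exact (pr_loc h i).2.2.1

end helpers

/-- Theorem 4Mar15: semisimplicity criterion for `'Q_{l,cl}(R)` via the minimal primes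
over `a = ass_R('C_R)`, together with the explicit description of the maximal left
denominator sets containing `'C_R` and the product decomposition of `'Q_{l,cl}(R)`. -/
theorem classicalLeftRegularLeftQuotient_semisimple_iff_minPrimes
    {R : Type u} [Ring R] [Nontrivial R] :
    -- (1) ↔ (2)
    ((IsLeftDenom (lReg R) ∧
        ∃ (Q : Type u) (_ : Ring Q) (f : R →+* Q),
          IsLeftLoc (lReg R) f ∧ IsSemisimpleRing Q) ↔
      -- (a)
      (IsSemiprimeIdealSet (ass (lReg R)) ∧
       (minPrimesOver (ass (lReg R))).Finite ∧
       -- (b)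
       (∀ p ∈ minPrimesOver (ass (lReg R)),
         IsLeftDenom (regMod p) ∧ ass (regMod p) = p) ∧
       -- (c)
       (∀ p ∈ minPrimesOver (ass (lReg R)),
         ∃ (Q : Type u) (_ : Ring Q) (f : R →+* Q),
           IsLeftLoc (regMod p) f ∧ SimpleArtinianRing Q) ∧
       -- (d)
       (∃ (Rb : Type u) (_ : Ring Rb) (π : R →+* Rb),
         IsQuotBy (ass (lReg R)) π ∧
         π '' lReg R ⊆ reg Rb ∧ DenseIn (π '' lReg R) (reg Rb)))) ∧
    -- Moreover, when the equivalent conditions hold: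
    ((IsLeftDenom (lReg R) ∧
        ∃ (Q : Type u) (_ : Ring Q) (f : R →+* Q),
          IsLeftLoc (lReg R) f ∧ IsSemisimpleRing Q) →
      -- (i) 'M = {S_p | p ∈ Min_R(a)} and ass_R(S_p) = p
      ({S : Set R | S ∈ maxLeftDenom R ∧ lReg R ⊆ S} =
        {S : Set R | ∃ p ∈ minPrimesOver (ass (lReg R)), S = regMod p}) ∧
      (∀ p ∈ minPrimesOver (ass (lReg R)), ass (regMod p) = p) ∧
      -- 'Q_{l,cl}(R) ≅ ∏_{p ∈ Min_R(a)} S_p⁻¹R ≅ Q_{l,cl}(R/a), semisimple Artinian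
      (∀ (Q0 : Type u) (_ : Ring Q0) (f0 : R →+* Q0), IsLeftLoc (lReg R) f0 →
        IsSemisimpleRing Q0 ∧
        (∀ (Qp : ↥(minPrimesOver (ass (lReg R))) → Type u) [∀ p, Ring (Qp p)]
            (fp : ∀ p : ↥(minPrimesOver (ass (lReg R))), R →+* Qp p),
          (∀ p, IsLeftLoc (regMod p.1) (fp p)) →
            (∀ p, SimpleArtinianRing (Qp p)) ∧ Nonempty (Q0 ≃+* ∀ p, Qp p)) ∧
        (∀ (Rb : Type u) (_ : Ring Rb) (π : R →+* Rb), IsQuotBy (ass (lReg R)) π →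
          ∀ (Q3 : Type u) (_ : Ring Q3) (f3 : Rb →+* Q3),
            IsLeftLoc (reg Rb) f3 → Nonempty (Q0 ≃+* Q3)))) := by

  obtain ⟨hC1, hCm⟩ := mulClosed_lReg R
  have hC0 := zero_notMem_lReg R
  refine ⟨⟨?_, ?_⟩, ?_⟩
  · rintro ⟨-, Q, _, f, hf, hQ⟩
    obtain ⟨h1, h2, h3, h4, -⟩ := forward hC1 hCm hf
    refine ⟨h1, h2, h3, h4, ?_⟩
    obtain ⟨Rb, _, π, hπ⟩ := exists_quot f hf.2.2
    exact ⟨Rb, _, π, hπ, cond_d hf hπ⟩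
  · rintro ⟨h1, h2, h3, h4, Rb, _, π, hπ, hreg, hd⟩
    choose Qp hr fp hloc hQ using fun p : ↥(minPrimesOver (ass (lReg R))) => h4 p.1 p.2
    have key := prod_isLeftLoc hC1 h1 h2 Qp fp hQ hloc (fun p hp => (h3 p hp).2) hπ hreg hd
    have := h2.to_subtype
    have hss : ∀ p, IsSemisimpleRing (Qp p) := fun p => (hQ p).isSemisimpleRing
    exact ⟨key.isLeftDenom hC1 hCm hC0, ∀ p, Qp p, inferInstance, RingHom.pi fp, key, inferInstance⟩
  · rintro ⟨-, Q, _, f, hf, hQ⟩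
    obtain ⟨h1, h2, h3, h4, h5⟩ := forward hC1 hCm hf
    refine ⟨h5, fun p hp => (h3 p hp).2, ?_⟩
    intro Q0 _ f0 hf0
    obtain ⟨e0⟩ := IsLeftLoc.unique hC1 hCm hf hf0
    have hss0 : IsSemisimpleRing Q0 := e0.isSemisimpleRing
    refine ⟨hss0, ?_, ?_⟩
    · intro Qp _ fp hloc
      have hQp : ∀ p, SimpleArtinianRing (Qp p) := by
        intro p
        obtain ⟨B, _, g, hg, hB⟩ := h4 p.1 p.2
        obtain ⟨e⟩ := IsLeftLoc.unique (mulClosed_regMod _).1 (mulClosed_regMod _).2 hg (hloc p)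
        exact hB.of_equiv e
      refine ⟨hQp, ?_⟩
      obtain ⟨Rb, _, π, hπ⟩ := exists_quot f hf.2.2
      obtain ⟨hreg, hd⟩ := cond_d hf hπ
      exact IsLeftLoc.unique hC1 hCm hf0
        (prod_isLeftLoc hC1 h1 h2 Qp fp hQp hloc (fun p hp => (h3 p hp).2) hπ hreg hd)
    · intro Rb _ π hπ Q3 _ f3 hf3
      obtain ⟨hreg, hd⟩ := cond_d hf hπ
      exact IsLeftLoc.unique hC1 hCm hf0 (comp_isLeftLoc hπ hreg hd hf3)

end Bavula
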